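/- Let A and B be countable groups, let C be a finite group with injective homomorphisms into A and into B, and let G = A ∗_C B be the amalgamated free product. Then, inside the space F(ℓ²(G)) of finite rank bounded operators on ℓ²(G), the intersection of the ℂ-subspaces F(ℓ²(G))·I_{ℂ[A]} and F(ℓ²(G))·I_{ℂ[B]} is exactly F(ℓ²(G))·I_{ℂ[C]}. -/

import Mathlib

noncomputable section

open ComplexConjugate
open scoped ENNReal

local notation "⟪" x ", " y "⟫" => @inner ℂ _ _ x y

/-- ℓ²(G): square summable complex valued functions. -/
abbrev L2 (G : Type) : Type := lp (fun _ : G => ℂ) 2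

/-- The standard orthonormal basis vector δ_g of ℓ²(G). -/
def delta {G : Type} (g : G) : L2 G :=
  letI := Classical.decEq G
  lp.single 2 g 1

theorem memℓp_comp_equiv {G : Type} (e : G ≃ G) (x : L2 G) :
    Memℓp (fun g => x (e g)) 2 := by
  have h2 : (0:ℝ) < (2:ℝ≥0∞).toReal := by norm_num
  rw [memℓp_gen_iff h2]
  have hx : Summable fun i => ‖x i‖ ^ (2:ℝ≥0∞).toReal := (memℓp_gen_iff h2).1 (lp.memℓp x)
  exact (e.summable_iff (f := fun i => ‖x i‖ ^ (2:ℝ≥0∞).toReal)).2 hx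

/-- The isometry of ℓ²(G) induced by precomposition with a bijection of G. -/
def lpShift {G : Type} (e : G ≃ G) : L2 G ≃ₗᵢ[ℂ] L2 G where
  toFun x := ⟨fun g => x (e g), memℓp_comp_equiv e x⟩
  invFun x := ⟨fun g => x (e.symm g), memℓp_comp_equiv e.symm x⟩
  left_inv x := by
    apply Subtype.ext
    funext g
    simp
  right_inv x := by
    apply Subtype.ext
    funext g
    simp
  map_add' x y := by
    apply Subtype.ext
    funext g
    simp only [lp.coeFn_add]
    rfl
  map_smul' c x := by
    apply Subtype.ext
    funext g
    simp [lp.coeFn_smul, Pi.smul_apply]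
  norm_map' x := by
    have h2 : (0:ℝ) < (2:ℝ≥0∞).toReal := by norm_num
    rw [lp.norm_eq_tsum_rpow h2, lp.norm_eq_tsum_rpow h2]
    congr 1
    exact e.tsum_eq (f := fun g => ‖x g‖ ^ (2:ℝ≥0∞).toReal)

/-- Right translation operator R_h : δ_g ↦ δ_{gh}. -/
def Rop {G : Type} [Group G] (h : G) : L2 G →L[ℂ] L2 G :=
  (lpShift (Equiv.mulRight h⁻¹)).toLinearIsometry.toContinuousLinearMap

/-- Left translation operator L_h : δ_g ↦ δ_{hg}. -/
def Lop {G : Type} [Group G] (h : G) : L2 G →L[ℂ] L2 G :=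
  (lpShift (Equiv.mulLeft h⁻¹)).toLinearIsometry.toContinuousLinearMap

/-- A bounded operator has finite rank if its range is finite dimensional. -/
def FiniteRank {G : Type} (T : L2 G →L[ℂ] L2 G) : Prop :=
  FiniteDimensional ℂ ↥(LinearMap.range (T : L2 G →ₗ[ℂ] L2 G))

/-- The right action T·g := R_g ∘ T ∘ R_{g⁻¹} of G on operators. -/
def opAct {G : Type} [Group G] (T : L2 G →L[ℂ] L2 G) (g : G) : L2 G →L[ℂ] L2 G :=
  Rop g ∘L T ∘L Rop g⁻¹

/-- The subspace F(ℓ²(G))·I_{ℂ[H]}: the ℂ-linear span of the operators T - T·h with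
T of finite rank and h ∈ H. -/
def FIdeal {G : Type} [Group G] (H : Subgroup G) : Submodule ℂ (L2 G →L[ℂ] L2 G) :=
  Submodule.span ℂ
    {S | ∃ (T : L2 G →L[ℂ] L2 G) (h : G), FiniteRank T ∧ h ∈ H ∧ S = T - opAct T h}

/-- The trace of a (finite rank) operator on ℓ²(G). -/
def opTrace {G : Type} (T : L2 G →L[ℂ] L2 G) : ℂ :=
  ∑' g : G, ⟪delta g, T (delta g)⟫

/-- `G`, together with homomorphisms `iA`, `iB`, is the amalgamated free product
`A ∗_C B` of `A` and `B` along `fA : C →* A` and `fB : C →* B`: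
it satisfies the universal property of the pushout in the category of groups. -/
structure IsAmalgamatedProduct {A B C G : Type} [Group A] [Group B] [Group C] [Group G]
    (fA : C →* A) (fB : C →* B) (iA : A →* G) (iB : B →* G) : Prop where
  comm : iA.comp fA = iB.comp fB
  universal : ∀ {H : Type} [Group H] (jA : A →* H) (jB : B →* H),
    jA.comp fA = jB.comp fB → ∃! k : G →* H, k.comp iA = jA ∧ k.comp iB = jB

section AmalgamHelpers

/-- The subset of the amalgamated product cutting the tree at the base edge. -/
theorem exists_cut {A B C G : Type} [Group A] [Group B] [Group C] [Group G]
    (fA : C →* A) (fB : C →* B) (iA : A →* G) (iB : B →* G)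
    (hG : IsAmalgamatedProduct fA fB iA iB) :
    ∃ W : Set G, (∀ g a, g * iA a ∈ W ↔ g ∈ W) ∧
      (∀ g b, g * iB b ∈ W ∪ ((iA.comp fA).range : Set G) ↔
        g ∈ W ∪ ((iA.comp fA).range : Set G)) ∧
      Disjoint W ((iA.comp fA).range : Set G) := by
  classical
  set K : Subgroup G := (iA.comp fA).range with hK
  -- the set-flipping involution
  let t : G → Bool := fun x => decide (x ∈ K)
  have tc : ∀ (c : C) x, t (iB (fB c) * x) = t x := by
    intro c x
    have hc : iB (fB c) ∈ K := by
      refine ⟨c, ?_⟩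
      exact DFunLike.congr_fun hG.comm c
    simp only [t, K.mul_mem_cancel_left hc]
  let P : Subgroup (Equiv.Perm (G × Bool) × G) :=
    { carrier := {p | ∀ x, (p.1 x).1 = p.2 * x.1}
      one_mem' := by intro x; simp
      mul_mem' := by
        intro p q hp hq x
        have h1 := hp (q.1 x)
        have h2 := hq x
        simp only [Prod.fst_mul, Prod.snd_mul, Equiv.Perm.mul_apply]
        rw [h1, h2, mul_assoc]
      inv_mem' := by
        intro p hp x
        have h1 := hp (p.1⁻¹ x)
        simp only [Prod.fst_inv, Prod.snd_inv]
        have h2 : p.1 (p.1⁻¹ x) = x := p.1.apply_symm_apply x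
        rw [h2] at h1
        rw [h1, inv_mul_cancel_left] }
  let sA : A →* Equiv.Perm (G × Bool) :=
    { toFun := fun a =>
        { toFun := fun x => (iA a * x.1, x.2)
          invFun := fun x => (iA a⁻¹ * x.1, x.2)
          left_inv := by intro x; simp
          right_inv := by intro x; simp }
      map_one' := by ext x <;> simp
      map_mul' := by intro a b; ext x <;> simp [mul_assoc] }
  let sB : B →* Equiv.Perm (G × Bool) :=
    { toFun := fun a =>
        { toFun := fun x => (iB a * x.1, xor (xor x.2 (t x.1)) (t (iB a * x.1)))
          invFun := fun x => (iB a⁻¹ * x.1, xor (xor x.2 (t x.1)) (t (iB a⁻¹ * x.1)))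
          left_inv := by intro x; ext <;> simp
          right_inv := by intro x; ext <;> simp }
      map_one' := by ext x <;> simp
      map_mul' := by intro a b; ext x <;> simp [mul_assoc] }
  let jA : A →* P := (sA.prod iA).codRestrict P (by intro a x; rfl)
  let jB : B →* P := (sB.prod iB).codRestrict P (by intro a x; rfl)
  have hj : jA.comp fA = jB.comp fB := by
    ext c x
    · have := DFunLike.congr_fun hG.comm c
      simp only [MonoidHom.comp_apply] at this
      simp [jA, jB, sA, sB, this]
    · have := DFunLike.congr_fun hG.comm c
      simp only [MonoidHom.comp_apply] at this
      simp [jA, jB, sA, sB, tc]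
    · have := DFunLike.congr_fun hG.comm c
      exact this
  obtain ⟨k, ⟨hkA, hkB⟩, -⟩ := hG.universal jA jB hj
  have hk2 : ∀ g, (k g).1.2 = g := by
    obtain ⟨k0, -, hu⟩ := hG.universal iA iB hG.comm
    have e1 := hu (((MonoidHom.snd _ _).comp P.subtype).comp k) ⟨by
        rw [MonoidHom.comp_assoc, hkA]; rfl, by
        rw [MonoidHom.comp_assoc, hkB]; rfl⟩
    have e2 := hu (MonoidHom.id G) ⟨rfl, rfl⟩
    intro g
    exact DFunLike.congr_fun (e1.trans e2.symm) g
  have hk1 : ∀ g x, ((k g).1.1 x).1 = g * x.1 := by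
    intro g x
    have := (k g).2 x
    rwa [hk2] at this
  have kA : ∀ a, (k (iA a)).1.1 = sA a := fun a => by
    have := DFunLike.congr_fun hkA a
    simp only [MonoidHom.comp_apply] at this
    rw [this]; rfl
  have kB : ∀ a, (k (iB a)).1.1 = sB a := fun a => by
    have := DFunLike.congr_fun hkB a
    simp only [MonoidHom.comp_apply] at this
    rw [this]; rfl
  let i : G → Bool := fun g => ((k g⁻¹).1.1 (1, false)).2
  have hiA : ∀ g a, i (g * iA a) = i g := by
    intro g a
    simp only [i, mul_inv_rev, map_mul, ← map_inv, Subgroup.coe_mul, Prod.fst_mul,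
      Equiv.Perm.mul_apply]
    rw [kA]
    simp [sA]
  have htinv : ∀ g, t g⁻¹ = t g := by intro g; simp [t]
  have hiB : ∀ g b, i (g * iB b) = xor (xor (i g) (t g)) (t (g * iB b)) := by
    intro g b
    rw [← htinv g, ← htinv (g * iB b)]
    simp only [i, mul_inv_rev, map_mul, ← map_inv, Subgroup.coe_mul, Prod.fst_mul,
      Equiv.Perm.mul_apply]
    rw [kB]
    have h3 := hk1 g⁻¹ (1, false)
    rw [mul_one] at h3
    change xor (xor _ (t ((k g⁻¹).1.1 (1, false)).1))
      (t (iB b⁻¹ * ((k g⁻¹).1.1 (1, false)).1)) = _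
    rw [h3]
  have hi1 : ∀ g ∈ K, i g = false := by
    rintro _ ⟨c, rfl⟩
    have := hiA 1 (fA c)
    simp only [one_mul] at this
    rw [MonoidHom.comp_apply, this]
    simp only [i, inv_one, map_one]
    rfl
  have hmem : ∀ g, g ∈ {g | i g = true} ∪ (K : Set G) ↔ xor (i g) (t g) = true := by
    intro g
    by_cases h : g ∈ K
    · simp [h, t, hi1 g h]
    · simp [h, t]
  refine ⟨{g | i g = true}, fun g a => by simp [hiA], fun g b => ?_, ?_⟩
  · rw [hmem, hmem, hiB]; simp
  · rw [Set.disjoint_left]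
    intro g hg hgK
    have := hi1 g hgK
    simp only [Set.mem_ofPred_eq] at hg
    simp [hg] at this

theorem exists_coset_equiv {G : Type} [Group G] (H : Subgroup G) :
    ∃ e : (G ⧸ H) × H ≃ G, ∀ q h, e (q, h) = q.out * (h : G) := by
  refine ⟨Equiv.ofBijective (fun p : (G ⧸ H) × H => p.1.out * (p.2 : G)) ⟨?_, ?_⟩,
    fun q h => rfl⟩
  · rintro ⟨q, h⟩ ⟨q', h'⟩ heq
    simp only at heq
    have h1 : ∀ (q : G ⧸ H) (h : H), ((q.out * (h : G) : G) : G ⧸ H) = q := by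
      intro q h
      rw [QuotientGroup.mk_mul_of_mem _ h.2]
      exact Quotient.out_eq' q
    have h2 : q = q' := by rw [← h1 q h, heq, h1]
    subst h2
    rw [Subtype.ext (mul_left_cancel heq)]
  · intro g
    refine ⟨((g : G ⧸ H), ⟨(g : G ⧸ H).out⁻¹ * g, ?_⟩), ?_⟩
    · rw [← QuotientGroup.eq]
      exact Quotient.out_eq' (g : G ⧸ H)
    · exact mul_inv_cancel_left _ _

theorem tsum_indicator_eq_zero {G : Type} [Group G] (H : Subgroup G) (u : G → ℂ)
    (hu : Summable u) (h0 : ∀ g, ∑' h : H, u (g * h) = 0) (W : Set G)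
    (hW : ∀ g, ∀ h ∈ H, g * h ∈ W ↔ g ∈ W) : ∑' x, W.indicator u x = 0 := by
  classical
  obtain ⟨e, he⟩ := exists_coset_equiv H
  have hs : Summable (W.indicator u) := hu.indicator W
  rw [← e.tsum_eq]
  have hs' : Summable fun p => W.indicator u (e p) := e.summable_iff.2 hs
  rw [hs'.tsum_prod]
  have : ∀ q : G ⧸ H, ∑' h : H, W.indicator u (e (q, h)) = 0 := by
    intro q
    by_cases hq : q.out ∈ W
    · rw [← h0 q.out]
      refine tsum_congr fun h => ?_
      rw [Set.indicator_of_mem, he]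
      rw [he]
      exact (hW _ _ h.2).2 hq
    · rw [← tsum_zero (α := ℂ) (β := H)]
      refine tsum_congr fun h => ?_
      rw [Set.indicator_of_notMem]
      rw [he]
      exact fun h' => hq ((hW _ _ h.2).1 h')
  simp [this]

theorem base_sum_eq_zero {A B C G : Type} [Group A] [Group B] [Group C] [Group G]
    (fA : C →* A) (fB : C →* B) (iA : A →* G) (iB : B →* G)
    (hG : IsAmalgamatedProduct fA fB iA iB) (u : G → ℂ) (hu : Summable u)
    (hA : ∀ g, ∑' h : iA.range, u (g * h) = 0)
    (hB : ∀ g, ∑' h : iB.range, u (g * h) = 0) (g : G) :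
    ∑' h : (iA.comp fA).range, u (g * h) = 0 := by
  obtain ⟨W, hWA, hWB, hd⟩ := exists_cut fA fB iA iB hG
  set K := (iA.comp fA).range
  let v : G → ℂ := fun x => u (g * x)
  have hv : Summable v := (Equiv.mulLeft g).summable_iff.2 hu
  have h1 := tsum_indicator_eq_zero iA.range v hv
    (fun x => by simpa [v, mul_assoc] using hA (g * x)) W
    (by rintro x _ ⟨a, rfl⟩; exact hWA x a)
  have h2 := tsum_indicator_eq_zero iB.range v hv
    (fun x => by simpa [v, mul_assoc] using hB (g * x)) (W ∪ (K : Set G))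
    (by rintro x _ ⟨a, rfl⟩; exact hWB x a)
  rw [Set.indicator_union_of_disjoint hd,
    (hv.indicator W).tsum_add (hv.indicator _), h1, zero_add] at h2
  rw [← tsum_subtype] at h2
  exact h2

theorem entry_opAct {G : Type} [Group G] (T : L2 G →L[ℂ] L2 G) (h x y : G) :
    (opAct T h (delta x) : G → ℂ) y = (T (delta (x * h⁻¹)) : G → ℂ) (y * h⁻¹) := by
  have hd : Rop h⁻¹ (delta x) = delta (x * h⁻¹) := by
    classical
    apply lp.ext
    funext z
    change (delta x : G → ℂ) (z * h⁻¹⁻¹) = _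
    simp only [delta, lp.single_apply]
    simp only [Pi.single_apply, inv_inv, eq_mul_inv_iff_mul_eq]
  change (T (Rop h⁻¹ (delta x)) : G → ℂ) (y * h⁻¹) = _
  rw [hd]

theorem op_ext {G : Type} (T : L2 G →L[ℂ] L2 G)
    (h : ∀ x y, (T (delta x) : G → ℂ) y = 0) : T = 0 := by
  classical
  ext1 f
  have h1 := (lp.hasSum_single (E := fun _ : G => ℂ) (p := 2) (by norm_num) f).mapL T
  have h2 : ∀ x, T (lp.single 2 x (f x)) = 0 := by
    intro x
    have : (lp.single 2 x (f x) : L2 G) = f x • delta x := by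
      rw [delta, ← lp.single_smul]; simp
    rw [this, map_smul]
    have : T (delta x) = 0 := by
      apply lp.ext; funext y; simpa using h x y
    rw [this, smul_zero]
  simp only [h2] at h1
  exact h1.unique hasSum_zero

theorem summable_mul_L2 {G : Type} (e : G ≃ G) (x y : L2 G) :
    Summable fun g => x g * y (e g) := by
  have h2 : (0:ℝ) < (2:ℝ≥0∞).toReal := by norm_num
  have hx : Summable fun i => ‖x i‖ ^ (2:ℝ≥0∞).toReal := (memℓp_gen_iff h2).1 (lp.memℓp x)
  have hy : Summable fun i => ‖y i‖ ^ (2:ℝ≥0∞).toReal := (memℓp_gen_iff h2).1 (lp.memℓp y)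
  have hy' : Summable fun i => ‖y (e i)‖ ^ (2:ℝ≥0∞).toReal :=
    (e.summable_iff (f := fun i => ‖y i‖ ^ (2:ℝ≥0∞).toReal)).2 hy
  refine Summable.of_norm_bounded (hx.add hy') fun g => ?_
  rw [norm_mul]
  simp only [ENNReal.toReal_ofNat, Real.rpow_ofNat]
  nlinarith [sq_nonneg (‖x g‖ - ‖y (e g)‖), sq_nonneg (‖x g‖), sq_nonneg (‖y (e g)‖)]

theorem inner_delta {G : Type} (f : L2 G) (x : G) : inner ℂ f (delta x) = conj (f x) := by
  classical
  rw [delta]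
  have := lp.inner_single_right (𝕜 := ℂ) (G := fun _ : G => ℂ) x (1 : ℂ) f
  rw [show (Classical.decEq G) = (fun a b => Classical.propDecidable (a = b)) from
    Subsingleton.elim _ _]
  rw [this]
  simp

theorem FiniteRank.summable {G : Type} {T : L2 G →L[ℂ] L2 G} (hT : FiniteRank T) (e : G ≃ G) :
    Summable fun g => (T (delta (e g)) : G → ℂ) g := by
  have : FiniteDimensional ℂ (LinearMap.range (T : L2 G →ₗ[ℂ] L2 G)) := hT
  let V := LinearMap.range (T : L2 G →ₗ[ℂ] L2 G)
  let b := stdOrthonormalBasis ℂ V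
  have key : ∀ f g, (T f : G → ℂ) g = ∑ j, inner ℂ (T.adjoint (b j : L2 G)) f *
      (b j : L2 G) g := by
    intro f g
    have h1 := b.sum_repr ⟨T f, ⟨f, rfl⟩⟩
    have h2 := congrArg (fun z : V => ((z : L2 G) : G → ℂ) g) h1
    simp only at h2
    rw [← h2]
    simp only [Submodule.coe_sum, lp.coeFn_sum, Finset.sum_apply, Submodule.coe_smul,
      lp.coeFn_smul, Pi.smul_apply, smul_eq_mul]
    refine Finset.sum_congr rfl fun j _ => ?_
    rw [b.repr_apply_apply, ContinuousLinearMap.adjoint_inner_left]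
    rfl
  simp only [key]
  refine summable_sum fun j _ => ?_
  have h := summable_mul_L2 e (star (b j : L2 G)) (T.adjoint (b j : L2 G))
  refine (h.map (starRingEnd ℂ) Complex.continuous_conj).congr fun g => ?_
  simp [inner_delta, mul_comm]

theorem FiniteRank.opAct {G : Type} [Group G] {T : L2 G →L[ℂ] L2 G} (hT : FiniteRank T) (h : G) :
    FiniteRank (opAct T h) := by
  have : FiniteDimensional ℂ (LinearMap.range (T : L2 G →ₗ[ℂ] L2 G)) := hT
  refine Submodule.finiteDimensional_of_le
    (S₂ := (LinearMap.range (T : L2 G →ₗ[ℂ] L2 G)).map (Rop h : L2 G →ₗ[ℂ] L2 G)) ?_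
  rintro _ ⟨x, rfl⟩
  exact ⟨_, ⟨_, rfl⟩, rfl⟩

theorem FiniteRank.add {G : Type} {S T : L2 G →L[ℂ] L2 G} (hS : FiniteRank S)
    (hT : FiniteRank T) : FiniteRank (S + T) := by
  have : FiniteDimensional ℂ (LinearMap.range (T : L2 G →ₗ[ℂ] L2 G)) := hT
  have : FiniteDimensional ℂ (LinearMap.range (S : L2 G →ₗ[ℂ] L2 G)) := hS
  refine Submodule.finiteDimensional_of_le
    (S₂ := LinearMap.range (S : L2 G →ₗ[ℂ] L2 G) ⊔ LinearMap.range (T : L2 G →ₗ[ℂ] L2 G)) ?_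
  rintro _ ⟨x, rfl⟩
  exact Submodule.add_mem_sup ⟨x, rfl⟩ ⟨x, rfl⟩

theorem FiniteRank.smul {G : Type} {T : L2 G →L[ℂ] L2 G} (c : ℂ)
    (hT : FiniteRank T) : FiniteRank (c • T) := by
  have : FiniteDimensional ℂ (LinearMap.range (T : L2 G →ₗ[ℂ] L2 G)) := hT
  refine Submodule.finiteDimensional_of_le
    (S₂ := LinearMap.range (T : L2 G →ₗ[ℂ] L2 G)) ?_
  rintro _ ⟨x, rfl⟩
  exact Submodule.smul_mem _ c ⟨x, rfl⟩

theorem FiniteRank.zero {G : Type} : FiniteRank (0 : L2 G →L[ℂ] L2 G) := by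
  refine Submodule.finiteDimensional_of_le (S₂ := ⊥) ?_
  rintro _ ⟨x, rfl⟩
  simp

theorem FIdeal_finiteRank {G : Type} [Group G] (H : Subgroup G) {X : L2 G →L[ℂ] L2 G}
    (hX : X ∈ FIdeal H) : FiniteRank X := by
  induction hX using Submodule.span_induction with
  | mem x hx =>
    obtain ⟨T, h, hT, -, rfl⟩ := hx
    have := hT.add ((hT.opAct h).smul (-1))
    rwa [neg_one_smul, ← sub_eq_add_neg] at this
  | zero => exact FiniteRank.zero
  | add x y _ _ hx hy => exact hx.add hy
  | smul c x _ hx => exact hx.smul c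

theorem FIdeal_sum {G : Type} [Group G] (H : Subgroup G) {X : L2 G →L[ℂ] L2 G}
    (hX : X ∈ FIdeal H) (k g : G) :
    ∑' h : H, (X (delta (k * (g * h))) : G → ℂ) (g * h) = 0 := by
  have hsum : ∀ {T : L2 G →L[ℂ] L2 G}, FiniteRank T →
      Summable fun h : H => (T (delta (k * (g * h))) : G → ℂ) (g * h) := by
    intro T hT
    have h1 := hT.summable (Equiv.mulLeft k)
    exact h1.comp_injective (i := fun h : H => g * (h : G))
      (fun a b hab => Subtype.ext (mul_left_cancel hab))
  induction hX using Submodule.span_induction with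
  | mem x hx =>
    obtain ⟨T, h, hT, hh, rfl⟩ := hx
    have e1 := (hsum hT).tsum_sub (hsum (hT.opAct h))
    have e2 : ∑' h' : H, (opAct T h (delta (k * (g * h'))) : G → ℂ) (g * h') =
        ∑' h' : H, (T (delta (k * (g * h'))) : G → ℂ) (g * h') := by
      rw [← (Equiv.mulRight (⟨h, hh⟩ : H)⁻¹).tsum_eq
        (fun h' : H => (T (delta (k * (g * h'))) : G → ℂ) (g * h'))]
      refine tsum_congr fun h' => ?_
      rw [entry_opAct]
      simp [mul_assoc]
    rw [e2, sub_self] at e1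
    rw [← e1]
    rfl
  | zero => simp
  | add x y hx hy h1 h2 =>
    have e1 := (hsum (FIdeal_finiteRank H hx)).tsum_add (hsum (FIdeal_finiteRank H hy))
    rw [h1, h2, add_zero] at e1
    rw [← e1]
    rfl
  | smul c x hx h1 =>
    have e1 := (hsum (FIdeal_finiteRank H hx)).tsum_const_smul c
    rw [h1, smul_zero] at e1
    rw [← e1]
    rfl

end AmalgamHelpers

/-- Let `G = A ∗_C B` be an amalgamated free product of countable groups
`A` and `B` over a finite group `C` (identified with their images in `G`). Inside the
space of finite rank bounded operators on `ℓ²(G)`, the intersection of the subspaces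
`F(ℓ²(G))·I_{ℂ[A]}` and `F(ℓ²(G))·I_{ℂ[B]}` is exactly `F(ℓ²(G))·I_{ℂ[C]}`. -/
theorem fideal_inf_of_amalgamated_free_product
    (A B C G : Type) [Group A] [Group B] [Group C] [Group G]
    [Countable A] [Countable B] [Finite C]
    (fA : C →* A) (fB : C →* B)
    (hfA : Function.Injective fA) (hfB : Function.Injective fB)
    (iA : A →* G) (iB : B →* G)
    (hG : IsAmalgamatedProduct fA fB iA iB) :
    FIdeal iA.range ⊓ FIdeal iB.range = FIdeal (iA.comp fA).range := by
  apply le_antisymm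
  · rintro X ⟨hXA, hXB⟩
    have hX := FIdeal_finiteRank _ hXA
    set K := (iA.comp fA).range with hK
    have : Finite K := by
      rw [hK]; exact Set.finite_range (iA.comp fA)
    have := Fintype.ofFinite K
    have hS : ∑ c : K, opAct X (c : G) = 0 := by
      apply op_ext
      intro x y
      have h := base_sum_eq_zero fA fB iA iB hG
        (fun g => (X (delta ((x * y⁻¹) * g)) : G → ℂ) g)
        (hX.summable (Equiv.mulLeft (x * y⁻¹)))
        (fun g => FIdeal_sum _ hXA _ g) (fun g => FIdeal_sum _ hXB _ g) y
      rw [tsum_fintype, ← Equiv.sum_comp (Equiv.inv K)] at h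
      rw [← h]
      simp only [_root_.sum_apply, lp.coeFn_sum, Finset.sum_apply, entry_opAct]
      refine Finset.sum_congr rfl fun c _ => ?_
      simp
    have hn : ((Fintype.card K : ℕ) : ℂ) ≠ 0 := by
      exact_mod_cast Fintype.card_ne_zero
    have hX2 : X = ((Fintype.card K : ℕ) : ℂ)⁻¹ • ∑ c : K, (X - opAct X (c : G)) := by
      rw [Finset.sum_sub_distrib, hS, sub_zero, Finset.sum_const, Finset.card_univ,
        ← Nat.cast_smul_eq_nsmul ℂ, smul_smul, inv_mul_cancel₀ hn, one_smul]
    rw [hX2]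
    refine Submodule.smul_mem _ _ (Submodule.sum_mem _ fun c _ => ?_)
    exact Submodule.subset_span ⟨X, c, hX, c.2, rfl⟩
  · refine le_inf (Submodule.span_mono ?_) (Submodule.span_mono ?_)
    · rintro _ ⟨T, h, hT, ⟨c, rfl⟩, rfl⟩
      exact ⟨T, _, hT, ⟨fA c, rfl⟩, rfl⟩
    · rintro _ ⟨T, h, hT, ⟨c, rfl⟩, rfl⟩
      refine ⟨T, _, hT, ⟨fB c, ?_⟩, rfl⟩
      exact (DFunLike.congr_fun hG.comm c).symm

end
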